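/- arXiv:1601.03546 — 2 statements merged into one kernel-verified Lean document; each statement's English description precedes it below -/
import Mathlib

section
/- Every proper elementary closed ideal J of a unital C*-algebra A is a Moore-Penrose ideal: if a ∈ A is invertible modulo J, then a is Moore-Penrose invertible in A. -/
/-- A closed two-sided ideal `J` of a C*-algebra is *elementary* if, as a
C*-algebra, it is *-isomorphic to the algebra of compact operators on some
Hilbert space. -/
def IsElementaryIdeal {A : Type*} [NonUnitalCStarAlgebra A] (J : TwoSidedIdeal A) : Prop :=
  ∃ (H : Type) (_ : NormedAddCommGroup H) (_ : InnerProductSpace ℂ H) (_ : CompleteSpace H)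
    (φ : A → (H →L[ℂ] H)),
      (∀ x ∈ J, ∀ y ∈ J, φ (x + y) = φ x + φ y) ∧
      (∀ (c : ℂ), ∀ x ∈ J, φ (c • x) = c • φ x) ∧
      (∀ x ∈ J, ∀ y ∈ J, φ (x * y) = φ x * φ y) ∧
      (∀ x ∈ J, φ (star x) = star (φ x)) ∧
      (∀ x ∈ J, ∀ y ∈ J, φ x = φ y → x = y) ∧
      (∀ x ∈ J, IsCompactOperator (φ x)) ∧
      (∀ T : H →L[ℂ] H, IsCompactOperator T → ∃ x ∈ J, φ x = T)


namespace MPAux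

/-- Trapezoidal bump functions. -/
noncomputable def psi (d n x : ℝ) : ℝ := max 0 (min 1 (n - |x| / d))

lemma psi_cont (d n : ℝ) : Continuous (psi d n) := by
  unfold psi; fun_prop

lemma psi_nonneg (d n x : ℝ) : 0 ≤ psi d n x := le_max_left _ _

lemma psi_le_one (d n x : ℝ) : psi d n x ≤ 1 := by
  unfold psi
  exact max_le zero_le_one (min_le_left _ _)

lemma psi_mul (d n x : ℝ) : psi d n x * psi d (n + 1) x = psi d n x := by
  by_cases h : n - |x| / d ≤ 0
  · have : psi d n x = 0 := by
      unfold psi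
      exact max_eq_left ((min_le_right _ _).trans h)
    simp [this]
  · have : psi d (n + 1) x = 1 := by
      unfold psi
      rw [min_eq_left (by linarith), max_eq_right zero_le_one]
    simp [this]

lemma psi_small (d n x : ℝ) (hd : 0 < d) (hn : 0 ≤ n) : |x| * psi d n x ≤ n * d := by
  by_cases h : n - |x| / d ≤ 0
  · have : psi d n x = 0 := by
      unfold psi
      exact max_eq_left ((min_le_right _ _).trans h)
    rw [this]; simpa using by positivity
  · have h1 : |x| / d < n := by linarith
    rw [div_lt_iff₀ hd] at h1
    have := psi_le_one d n x
    have := psi_nonneg d n x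
    nlinarith [abs_nonneg x]

lemma finite_ker {H : Type*} [NormedAddCommGroup H] [InnerProductSpace ℂ H] [CompleteSpace H]
    (K : H →L[ℂ] H) (hK : IsCompactOperator K) :
    FiniteDimensional ℂ (LinearMap.ker ((K - 1 : H →L[ℂ] H) : H →ₗ[ℂ] H)) := by
  set V := LinearMap.ker ((K - 1 : H →L[ℂ] H) : H →ₗ[ℂ] H) with hV
  have hmem : ∀ x, x ∈ V ↔ K x = x := by
    intro x
    simp [hV, sub_eq_zero]
  have hcl : IsClosed (V : Set H) := by
    have : (V : Set H) = {x | K x = x} := by ext x; exact hmem x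
    rw [this]
    exact isClosed_eq K.continuous continuous_id
  obtain ⟨S, hS, hsub⟩ := hK.image_closedBall_subset_compact 1
  refine FiniteDimensional.of_isCompact_closedBall ℂ (r := 1) one_pos (c := 0) ?_
  rw [Subtype.isCompact_iff]
  refine hS.of_isClosed_subset ?_ ?_
  · exact (hcl.isClosedEmbedding_subtypeVal.isClosedMap) _ Metric.isClosed_closedBall
  · rintro _ ⟨⟨x, hx⟩, hx1, rfl⟩
    refine hsub ⟨x, ?_, (hmem x).1 hx⟩
    simpa using hx1

lemma isolated {A : Type*} [CStarAlgebra A]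
    (J : TwoSidedIdeal A) (hJe : IsElementaryIdeal J)
    (a b : A) (hb : b * a - 1 ∈ J) :
    ∀ᶠ x in nhdsWithin (0 : ℝ) (spectrum ℝ (star a * a)), x = 0 := by
  obtain ⟨H, i1, i2, i3, φ, hadd, hsmul, hmul, -, hinj, hcpt, -⟩ := hJe
  set h := star a * a with hh
  have hsa : IsSelfAdjoint h := IsSelfAdjoint.star_mul_self a
  set d : ℝ := 1 / (3 * (‖b‖ ^ 2 + 1)) with hd
  have hd0 : 0 < d := by positivity
  set w := cfc (psi d 1) h with hw
  set f := cfc (psi d 2) h with hf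
  set g := cfc (psi d 3) h with hg
  have hgsa : star g = g := (cfc_predicate (R := ℝ) (psi d 3) h : IsSelfAdjoint g)
  have hfg : g * f = f := by
    rw [hg, hf, ← cfc_mul _ _ h (psi_cont _ _).continuousOn (psi_cont _ _).continuousOn]
    congr 1; ext x
    have := psi_mul d 2 x
    norm_num at this
    rw [mul_comm, this]
  have hghg : g * h * g = cfc (fun x => psi d 3 x * x * psi d 3 x) h := by
    have c1 := (psi_cont d 3)
    rw [cfc_mul (fun x => psi d 3 x * x) _ h (by fun_prop) (by fun_prop),
      cfc_mul _ (fun x => x) h (by fun_prop) (by fun_prop), cfc_id' ℝ h]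
  have hnorm : ‖a * g‖ ^ 2 ≤ 3 * d := by
    have : ‖a * g‖ ^ 2 = ‖g * h * g‖ := by
      rw [sq, ← CStarRing.norm_star_mul_self, star_mul, hgsa, hh]
      simp only [mul_assoc]
    rw [this, hghg]
    refine norm_cfc_le (by positivity) fun x _ => ?_
    have h1 := psi_small d 3 x hd0 (by norm_num)
    have h2 := psi_le_one d 3 x
    have h3 := psi_nonneg d 3 x
    rw [Real.norm_eq_abs, abs_mul, abs_mul, abs_of_nonneg h3]
    have : 0 ≤ |x| * psi d 3 x := by positivity
    nlinarith
  have hlt : ‖b * (a * g)‖ < 1 := by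
    have h1 : ‖b * (a * g)‖ ≤ ‖b‖ * ‖a * g‖ := norm_mul_le _ _
    have h2 : (‖b‖ * ‖a * g‖) ^ 2 < 1 := by
      rw [mul_pow]
      have : 3 * d = 1 / (‖b‖ ^ 2 + 1) := by rw [hd]; field_simp
      rw [this] at hnorm
      calc ‖b‖ ^ 2 * ‖a * g‖ ^ 2 ≤ ‖b‖ ^ 2 * (1 / (‖b‖ ^ 2 + 1)) := by gcongr
        _ < 1 := by
          rw [mul_one_div, div_lt_one (by positivity)]; linarith
    have h3 : ‖b‖ * ‖a * g‖ < 1 := by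
      by_contra hcon
      push Not at hcon
      nlinarith
    linarith
  have hfJ : f ∈ J := by
    have h1 : (1 - b * (a * g)) * f ∈ J := by
      have : (1 - b * (a * g)) * f = -((b * a - 1) * f) := by
        have : b * (a * g) * f = b * a * f := by
          rw [mul_assoc, mul_assoc a, hfg, mul_assoc]
        rw [sub_mul, this]; noncomm_ring
      rw [this]
      exact J.neg_mem (J.mul_mem_right _ _ hb)
    set u := Units.oneSub _ hlt with hu
    have h2 : (1 - b * (a * g)) = (u : A) := by simp [hu]
    rw [h2] at h1
    have := J.mul_mem_left (↑u⁻¹ : A) _ h1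
    rwa [Units.inv_mul_cancel_left] at this
  set K := φ f with hK
  have hKc := hcpt f hfJ
  have hfin := finite_ker K hKc
  set V := LinearMap.ker ((K - 1 : H →L[ℂ] H) : H →ₗ[ℂ] H) with hV
  have hmemV : ∀ x, x ∈ V ↔ K x = x := by
    intro x
    simp [hV, sub_eq_zero]
  let u : Polynomial ℝ → A := fun p => cfc (fun x => psi d 1 x * p.eval x) h
  have cu : ∀ p : Polynomial ℝ, Continuous (fun x => psi d 1 x * p.eval x) := fun p =>
    (psi_cont d 1).mul p.continuous
  have hfu : ∀ p, f * u p = u p := by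
    intro p
    simp only [u, hf]
    rw [← cfc_mul _ _ h (psi_cont _ _).continuousOn (cu p).continuousOn]
    congr 1; ext x
    have := psi_mul d 1 x
    norm_num at this
    rw [← mul_assoc, mul_comm (psi d 2 x), this]
  have huJ : ∀ p, u p ∈ J := fun p => by
    rw [← hfu p]; exact J.mul_mem_right _ _ hfJ
  have huadd : ∀ p q, u (p + q) = u p + u q := by
    intro p q
    simp only [u]
    rw [← cfc_add h _ _ (cu p).continuousOn (cu q).continuousOn]
    congr 1; ext x; simp [mul_add]
  have husmul : ∀ (c : ℝ) p, u (c • p) = (c : ℂ) • u p := by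
    intro c p
    simp only [u]
    have : (c : ℂ) • cfc (fun x => psi d 1 x * p.eval x) h
        = c • cfc (fun x => psi d 1 x * p.eval x) h := by
      exact Complex.coe_smul c _
    rw [this, ← cfc_smul c _ h (cu p).continuousOn]
    congr 1; ext x; simp; ring
  have hrange : ∀ p x, φ (u p) x ∈ V := by
    intro p x
    rw [hmemV, hK]
    have := hmul f hfJ (u p) (huJ p)
    rw [hfu] at this
    conv_rhs => rw [this]
    rfl
  let L : Polynomial ℝ →ₗ[ℝ] (V →ₗ[ℝ] V) :=
    { toFun := fun p =>
        { toFun := fun v => ⟨φ (u p) v, hrange p v⟩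
          map_add' := fun v v' => by ext; simp
          map_smul' := fun c v => by
            ext
            simp }
      map_add' := fun p q => by
        ext v
        simp [huadd, hadd _ (huJ p) _ (huJ q)]
      map_smul' := fun c p => by
        ext v
        have e : φ (u (c • p)) = (c : ℂ) • φ (u p) := by
          rw [husmul, hsmul _ _ (huJ p)]
        simp [e] }
  have hLni : ¬ Function.Injective L := by
    intro hi
    exact Polynomial.not_finite (R := ℝ) (Module.Finite.of_injective L hi)
  obtain ⟨p, hp0, hp⟩ : ∃ p : Polynomial ℝ, p ≠ 0 ∧ L p = 0 := by
    rw [injective_iff_map_eq_zero] at hLni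
    push Not at hLni
    obtain ⟨p, h1, h2⟩ := hLni
    exact ⟨p, h2, h1⟩
  have hzero : u p * u 1 = 0 := by
    have hJm : u p * u 1 ∈ J := J.mul_mem_right _ _ (huJ p)
    have hφ0 : φ 0 = 0 := by
      have := hsmul 0 0 J.zero_mem
      simpa using this
    refine hinj _ hJm _ J.zero_mem ?_
    rw [hmul _ (huJ p) _ (huJ 1), hφ0]
    ext x
    have := congrArg (fun T => ((T ⟨φ (u 1) x, hrange 1 x⟩ : V) : H)) hp
    simpa [L] using this
  have hspec : ∀ x ∈ spectrum ℝ h, psi d 1 x * p.eval x * psi d 1 x = 0 := by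
    have h1 : cfc (fun x => psi d 1 x * p.eval x * psi d 1 x) h = cfc (fun _ => (0 : ℝ)) h := by
      rw [cfc_mul (fun x => psi d 1 x * p.eval x) (psi d 1) h (cu p).continuousOn
        (psi_cont _ _).continuousOn]
      have : cfc (psi d 1) h = u 1 := by simp [u]
      rw [this, cfc_const_zero]
      exact hzero
    have := cfc_eq_cfc_iff_eqOn (R := ℝ) (a := h) hsa
      ((cu p).mul (psi_cont _ _)).continuousOn continuousOn_const |>.1 h1
    exact this
  have hψ0 : ∀ᶠ x in nhds (0 : ℝ), psi d 1 x ≠ 0 := by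
    refine (psi_cont d 1).continuousAt.eventually_ne ?_
    simp [psi]
  have hroots : ∀ᶠ x in nhds (0 : ℝ), x ∉ p.roots.toFinset.erase 0 := by
    have : IsClosed ((p.roots.toFinset.erase 0 : Finset ℝ) : Set ℝ) :=
      (Finset.finite_toSet _).isClosed
    exact this.isOpen_compl.mem_nhds (by simp)
  filter_upwards [nhdsWithin_le_nhds hψ0, nhdsWithin_le_nhds hroots, self_mem_nhdsWithin]
    with x hx1 hx2 hx3
  have := hspec x hx3
  simp only [mul_eq_zero, hx1, false_or, or_false] at this
  by_contra hne
  apply hx2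
  simp [hne, hp0, this]

end MPAux

theorem elementary_ideal_is_moore_penrose {A : Type*} [CStarAlgebra A]
    (J : TwoSidedIdeal A) (hJc : IsClosed (J : Set A)) (hJp : J ≠ ⊤)
    (hJe : IsElementaryIdeal J)
    (a : A) (ha : ∃ b : A, a * b - 1 ∈ J ∧ b * a - 1 ∈ J) :
    ∃ b : A, a * b * a = a ∧ b * a * b = b ∧
      star (a * b) = a * b ∧ star (b * a) = b * a := by
  obtain ⟨b, -, hb⟩ := ha
  have hiso := MPAux.isolated J hJe a b hb
  set h := star a * a with hh
  have hsa : IsSelfAdjoint h := IsSelfAdjoint.star_mul_self a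
  have hc : ContinuousOn (fun x : ℝ => x⁻¹) (spectrum ℝ h) := by
    intro x hx
    by_cases hx0 : x = 0
    · subst hx0
      refine (continuousWithinAt_const (b := (0 : ℝ))).congr_of_eventuallyEq ?_ (by simp)
      filter_upwards [hiso] with y hy
      simp [hy]
    · exact (continuousAt_inv₀ hx0).continuousWithinAt
  set g := cfc (fun x : ℝ => x⁻¹) h with hg
  have hgsa : star g = g := (cfc_predicate (R := ℝ) _ h : IsSelfAdjoint g)
  have hhs : star h = h := hsa
  have hgh : g * h = cfc (fun x : ℝ => x⁻¹ * x) h := by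
    rw [cfc_mul _ (fun x => x) h hc (by fun_prop), cfc_id' ℝ h]
  have hce : ContinuousOn (fun x : ℝ => x⁻¹ * x) (spectrum ℝ h) := hc.mul (by fun_prop)
  have hes : star (g * h) = g * h := by
    rw [hgh]; exact (cfc_predicate (R := ℝ) _ h : IsSelfAdjoint _)
  have hcomm : h * g = g * h := by
    rw [star_mul, hgsa, hhs] at hes; exact hes
  have hghg : g * h * g = g := by
    rw [hgh, hg, ← cfc_mul _ _ h hce hc]
    congr 1; ext x
    by_cases hx : x = 0 <;> simp [hx]
  have hhgh : h * (g * h) = h := by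
    rw [hgh]
    conv_lhs => rw [← cfc_id' ℝ h]
    nth_rewrite 2 [cfc_id' ℝ h]
    rw [← cfc_mul _ _ h (by fun_prop) hce]
    conv_rhs => rw [← cfc_id' ℝ h]
    congr 1; ext x
    by_cases hx : x = 0 <;> simp [hx]
  have hae : a * (g * h) = a := by
    have : a * (g * h) - a = 0 := by
      rw [← CStarRing.star_mul_self_eq_zero_iff]
      have e1 : star (a * (g * h) - a) * (a * (g * h) - a)
          = (g * h) * (h * (g * h)) - (g * h) * h - h * (g * h) + h := by
        rw [star_sub, star_mul, hes, hh]; noncomm_ring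
      rw [e1, hhgh]; noncomm_ring
    exact sub_eq_zero.1 this
  refine ⟨g * star a, ?_, ?_, ?_, ?_⟩
  · rw [show a * (g * star a) * a = a * (g * h) by rw [hh]; simp only [mul_assoc], hae]
  · rw [show g * star a * a * (g * star a) = g * h * g * star a by rw [hh]; simp only [mul_assoc],
      hghg]
  · simp [star_mul, hgsa, mul_assoc]
  · rw [mul_assoc, ← hh, hes]
end

section
/- Every dual ideal J of a unital C*-algebra A lifts projections: if a ∈ A is such that a + J is a projection in A/J, then the coset a + J contains a projection of A. -/
/-- A closed two-sided ideal `J` of a C*-algebra is *dual* if, as a C*-algebra,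
it is *-isomorphic to a c₀-direct sum of algebras of compact operators on
Hilbert spaces `H t`. -/
def IsDualIdeal {A : Type*} [NonUnitalCStarAlgebra A] (J : TwoSidedIdeal A) : Prop :=
  ∃ (T : Type) (H : T → Type) (_ : ∀ t, NormedAddCommGroup (H t))
    (_ : ∀ t, InnerProductSpace ℂ (H t)) (_ : ∀ t, CompleteSpace (H t))
    (φ : A → ∀ t, (H t →L[ℂ] H t)),
      (∀ x ∈ J, ∀ y ∈ J, φ (x + y) = φ x + φ y) ∧
      (∀ (c : ℂ), ∀ x ∈ J, φ (c • x) = c • φ x) ∧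
      (∀ x ∈ J, ∀ y ∈ J, φ (x * y) = φ x * φ y) ∧
      (∀ x ∈ J, φ (star x) = star (φ x)) ∧
      (∀ x ∈ J, ∀ y ∈ J, φ x = φ y → x = y) ∧
      (∀ x ∈ J, (∀ t, IsCompactOperator (φ x t)) ∧
        ∀ ε : ℝ, 0 < ε → {t : T | ε ≤ ‖φ x t‖}.Finite) ∧
      (∀ y : ∀ t, (H t →L[ℂ] H t),
        ((∀ t, IsCompactOperator (y t)) ∧ ∀ ε : ℝ, 0 < ε → {t : T | ε ≤ ‖y t‖}.Finite) →
        ∃ x ∈ J, φ x = y)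

/-- A compact self-adjoint operator has finitely many real spectral values away from zero. -/
theorem finite_spectrum_away {H : Type*} [NormedAddCommGroup H] [InnerProductSpace ℂ H]
    [CompleteSpace H] (S : H →L[ℂ] H) (hS : IsCompactOperator S) (hsa : star S = S)
    (d : ℝ) (hd : 0 < d) :
    {c : ℝ | d ≤ |c| ∧ (c : ℂ) ∈ spectrum ℂ S}.Finite := by
  set E := {c : ℝ | d ≤ |c| ∧ (c : ℂ) ∈ spectrum ℂ S} with hE
  have hsym : (S : H →ₗ[ℂ] H).IsSymmetric :=
    ContinuousLinearMap.isSelfAdjoint_iff_isSymmetric.mp hsa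
  have hev : ∀ c : E, ∃ v : H, ‖v‖ = 1 ∧ S v = ((c : ℝ) : ℂ) • v := by
    rintro ⟨c, hc1, hc2⟩
    have hc0 : (c : ℂ) ≠ 0 := by
      intro h
      have : c = 0 := by exact_mod_cast h
      rw [this, abs_zero] at hc1
      linarith
    have h1 := (IsCompactOperator.hasEigenvalue_iff_mem_spectrum hS hc0).mpr hc2
    obtain ⟨v, hv⟩ := h1.exists_hasEigenvector
    have hv0 := hv.2
    have hvS : S v = (c : ℂ) • v := hv.apply_eq_smul
    refine ⟨((‖v‖⁻¹ : ℝ) : ℂ) • v, ?_, ?_⟩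
    · rw [norm_smul]
      have : ‖v‖ ≠ 0 := norm_ne_zero_iff.mpr hv0
      simp [this]
    · rw [map_smul, hvS, smul_comm]
  choose e he1 heS using hev
  have horth : ∀ c c' : E, c ≠ c' → inner ℂ (e c) (e c') = 0 := by
    intro c c' hcc
    have h := hsym (e c) (e c')
    simp only [ContinuousLinearMap.coe_coe, heS, inner_smul_left, inner_smul_right,
      Complex.conj_ofReal] at h
    have h2 : (((c : ℝ) : ℂ) - ((c' : ℝ) : ℂ)) * inner ℂ (e c) (e c') = 0 := by
      rw [sub_mul, h, sub_self]
    rcases mul_eq_zero.mp h2 with h3 | h3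
    · exact absurd (Subtype.ext (by exact_mod_cast sub_eq_zero.mp h3)) hcc
    · exact h3
  have hsep : ∀ c c' : E, c ≠ c' → d ≤ dist (S (e c)) (S (e c')) := by
    intro c c' hcc
    have h0 : inner ℂ (S (e c)) (S (e c')) = 0 := by
      rw [heS, heS, inner_smul_left, inner_smul_right, horth c c' hcc]; simp
    have h1 := norm_sub_sq (𝕜 := ℂ) (S (e c)) (S (e c'))
    rw [h0] at h1
    have h2 : ‖S (e c)‖ = |(c : ℝ)| := by rw [heS, norm_smul, he1]; simp
    have h3 : d ≤ ‖S (e c)‖ := h2 ▸ c.2.1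
    rw [dist_eq_norm]
    refine le_of_sq_le_sq ?_ (norm_nonneg _)
    rw [h1]
    simp only [map_zero, mul_zero, sub_zero]
    nlinarith [sq_nonneg ‖S (e c')‖]
  obtain ⟨K, hK, hsub⟩ := IsCompactOperator.image_closedBall_subset_compact
    (f := (S : H →ₗ[ℂ] H)) hS 1
  obtain ⟨t, -, htf, ht⟩ := Metric.finite_approx_of_totallyBounded hK.totallyBounded (d / 2)
    (by positivity)
  have hcov : ∀ c : E, ∃ p : t, dist (S (e c)) p < d / 2 := by
    intro c
    have : S (e c) ∈ K := hsub ⟨e c, by simp [he1], rfl⟩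
    have := ht this
    simpa using this
  choose p hp using hcov
  have hinj : Function.Injective p := by
    intro c c' h
    by_contra hcc
    have h1 := hsep c c' hcc
    have h2 := dist_triangle_right (S (e c)) (S (e c')) (p c)
    have h3 := hp c
    have h4 := hp c'
    rw [← h] at h4
    linarith
  have : Finite t := htf
  exact Finite.of_injective p hinj

/-- The part of the proof that uses the structure of a dual ideal: resolvents. -/
theorem not_mem_spectrum_of_dual {A : Type*} [CStarAlgebra A]
    (J : TwoSidedIdeal A) {T : Type} {H : T → Type} [∀ t, NormedAddCommGroup (H t)]
    [∀ t, InnerProductSpace ℂ (H t)] [∀ t, CompleteSpace (H t)]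
    (φ : A → ∀ t, (H t →L[ℂ] H t))
    (hadd : ∀ x ∈ J, ∀ y ∈ J, φ (x + y) = φ x + φ y)
    (hsmul : ∀ (c : ℂ), ∀ x ∈ J, φ (c • x) = c • φ x)
    (hmul : ∀ x ∈ J, ∀ y ∈ J, φ (x * y) = φ x * φ y)
    (hinj : ∀ x ∈ J, ∀ y ∈ J, φ x = φ y → x = y)
    (hcpt : ∀ x ∈ J, (∀ t, IsCompactOperator (φ x t)) ∧
        ∀ ε : ℝ, 0 < ε → {t : T | ε ≤ ‖φ x t‖}.Finite)
    (hsurj : ∀ y : ∀ t, (H t →L[ℂ] H t),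
        ((∀ t, IsCompactOperator (y t)) ∧ ∀ ε : ℝ, 0 < ε → {t : T | ε ≤ ‖y t‖}.Finite) →
        ∃ x ∈ J, φ x = y)
    (h : A) (hh : h ∈ J) (c : ℂ) (hc : c ≠ 0) (hspec : ∀ t, c ∉ spectrum ℂ (φ h t)) :
    c ∉ spectrum ℂ h := by
  have hJs : ∀ (z : ℂ) (x : A), x ∈ J → z • x ∈ J := by
    intro z x hx
    have := J.mul_mem_left (z • 1) x hx
    simpa using this
  have hR : ∀ t, ∃ R : H t →L[ℂ] H t,
      (c • 1 - φ h t) * R = 1 ∧ R * (c • 1 - φ h t) = 1 := by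
    intro t
    have h1 := spectrum.notMem_iff.mp (hspec t)
    obtain ⟨u, hu⟩ := h1
    rw [Algebra.algebraMap_eq_smul_one] at hu
    exact ⟨↑u⁻¹, by rw [← hu]; simp, by rw [← hu]; simp⟩
  choose R hR1 hR2 using hR
  have hcomm : ∀ t, R t * φ h t = φ h t * R t := by
    intro t
    have h1 := hR1 t
    have h2 := hR2 t
    rw [sub_mul, smul_mul_assoc, one_mul] at h1
    rw [mul_sub, mul_smul_comm, mul_one] at h2
    have := h1.trans h2.symm
    exact (sub_right_injective this).symm
  set w : ∀ t, (H t →L[ℂ] H t) := fun t => (-c⁻¹) • (R t * φ h t) with hw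
  have e1 : ∀ t, φ h t * w t - c • w t = c⁻¹ • φ h t := by
    intro t
    have : φ h t * w t - c • w t = c⁻¹ • (((c • 1 - φ h t) * R t) * φ h t) := by
      simp only [hw, sub_mul, smul_mul_assoc, mul_smul_comm, one_mul, smul_sub, mul_assoc, neg_smul,
        smul_neg, smul_smul, mul_inv_cancel₀ hc, inv_mul_cancel₀ hc, mul_neg]
      abel
    rw [this, hR1, one_mul]
  have e2 : ∀ t, w t * φ h t - c • w t = c⁻¹ • φ h t := by
    intro t
    have : w t * φ h t = φ h t * w t := by
      simp only [hw, smul_mul_assoc, mul_smul_comm]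
      rw [← mul_assoc (φ h t), ← hcomm]
    rw [this, e1]
  have hwc : (∀ t, IsCompactOperator (w t)) ∧ ∀ ε : ℝ, 0 < ε → {t : T | ε ≤ ‖w t‖}.Finite := by
    obtain ⟨k1, k2⟩ := hcpt h hh
    refine ⟨fun t => ?_, fun ε hε => ?_⟩
    · exact ((k1 t).clm_comp (R t)).smul (-c⁻¹)
    · have hcn : 0 < ‖c‖ := norm_pos_iff.mpr hc
      refine ((k2 (‖c‖ / 2) (by positivity)).union
        (k2 (ε * ‖c‖ ^ 2 / 2) (by positivity))).subset ?_
      intro t ht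
      by_contra hcon
      simp only [Set.mem_union, Set.mem_ofPred_eq, not_or, not_le] at hcon ht
      obtain ⟨n1, n2⟩ := hcon
      have e3 : c • w t = φ h t * w t - c⁻¹ • φ h t := by rw [← e1 t]; abel
      have e4 : ‖c‖ * ‖w t‖ ≤ ‖φ h t‖ * ‖w t‖ + ‖c‖⁻¹ * ‖φ h t‖ := by
        calc ‖c‖ * ‖w t‖ = ‖c • w t‖ := (norm_smul _ _).symm
          _ ≤ ‖φ h t * w t‖ + ‖c⁻¹ • φ h t‖ := by rw [e3]; exact norm_sub_le _ _
          _ ≤ _ := by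
            gcongr
            · exact norm_mul_le _ _
            · rw [norm_smul, norm_inv]
      have e5 : ‖φ h t‖ * ‖w t‖ ≤ ‖c‖ / 2 * ‖w t‖ := by gcongr
      have e6 : ‖c‖⁻¹ * ‖φ h t‖ < ‖c‖⁻¹ * (ε * ‖c‖ ^ 2 / 2) := by gcongr
      have e7 : ‖c‖⁻¹ * (ε * ‖c‖ ^ 2 / 2) = ‖c‖ / 2 * ε := by field_simp
      have e8 : ‖c‖ / 2 * ε ≤ ‖c‖ / 2 * ‖w t‖ := by gcongr
      linarith
  obtain ⟨x, hx, hxw⟩ := hsurj w hwc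
  have hsubm : ∀ y ∈ J, φ (y - c • x) = φ y - c • φ x := by
    intro y hy
    rw [show y - c • x = y + (-c) • x by rw [neg_smul, sub_eq_add_neg],
      hadd y hy _ (hJs _ _ hx), hsmul _ _ hx, neg_smul, sub_eq_add_neg]
  have f1 : h * x - c • x = c⁻¹ • h := by
    refine hinj _ (J.sub_mem (J.mul_mem_left _ _ hx) (hJs _ _ hx)) _ (hJs _ _ hh) ?_
    rw [hsubm _ (J.mul_mem_left _ _ hx), hmul _ hh _ hx, hsmul _ _ hh, hxw]
    funext t
    exact e1 t
  have f2 : x * h - c • x = c⁻¹ • h := by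
    refine hinj _ (J.sub_mem (J.mul_mem_right _ _ hx) (hJs _ _ hx)) _ (hJs _ _ hh) ?_
    rw [hsubm _ (J.mul_mem_right _ _ hx), hmul _ hx _ hh, hsmul _ _ hh, hxw]
    funext t
    exact e2 t
  rw [spectrum.notMem_iff, Algebra.algebraMap_eq_smul_one]
  refine isUnit_iff_exists.mpr ⟨c⁻¹ • 1 - x, ?_, ?_⟩
  · have : (c • 1 - h) * (c⁻¹ • 1 - x) = 1 + (h * x - c • x - c⁻¹ • h) := by
      simp only [mul_sub, sub_mul, smul_mul_assoc, mul_smul_comm, one_mul, mul_one, smul_sub, smul_smul,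
        inv_mul_cancel₀ hc, mul_inv_cancel₀ hc, one_smul]
      abel
    rw [this, f1]; simp
  · have : (c⁻¹ • 1 - x) * (c • 1 - h) = 1 + (x * h - c • x - c⁻¹ • h) := by
      simp only [mul_sub, sub_mul, smul_mul_assoc, mul_smul_comm, one_mul, mul_one, smul_sub, smul_smul,
        inv_mul_cancel₀ hc, mul_inv_cancel₀ hc, one_smul]
      abel
    rw [this, f2]; simp

/-- Lifting for a self-adjoint element with a gap in its spectrum. -/
theorem lift_of_gap {A : Type*} [CStarAlgebra A] (J : TwoSidedIdeal A)
    (b : A) (hb : IsSelfAdjoint b) (hbJ : b * b - b ∈ J) (s : ℝ) (hs0 : 0 < s) (hs1 : s < 1)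
    (hs : s ∉ spectrum ℝ b) :
    ∃ q : A, (star q = q ∧ q * q = q) ∧ b - q ∈ J := by
  set f : ℝ → ℝ := fun t => if t < s then 0 else 1 with hf
  set k : ℝ → ℝ := fun t => if t < s then (t - 1)⁻¹ else t⁻¹ with hk
  have hfc : ContinuousOn f (spectrum ℝ b) := by
    intro t ht
    apply ContinuousAt.continuousWithinAt
    rcases lt_trichotomy t s with h | h | h
    · refine (continuousAt_const (y := (0 : ℝ))).congr ?_
      filter_upwards [eventually_lt_nhds h] with u hu
      simp [hf, hu]
    · exact absurd (h ▸ ht) hs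
    · refine (continuousAt_const (y := (1 : ℝ))).congr ?_
      filter_upwards [eventually_gt_nhds h] with u hu
      simp [hf, not_lt.mpr hu.le]
  have hkc : ContinuousOn k (spectrum ℝ b) := by
    intro t ht
    apply ContinuousAt.continuousWithinAt
    rcases lt_trichotomy t s with h | h | h
    · have : ContinuousAt (fun u : ℝ => (u - 1)⁻¹) t :=
        ContinuousAt.inv₀ (by fun_prop) (by linarith)
      refine this.congr ?_
      filter_upwards [eventually_lt_nhds h] with u hu
      simp [hk, hu]
    · exact absurd (h ▸ ht) hs
    · have : ContinuousAt (fun u : ℝ => u⁻¹) t :=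
        ContinuousAt.inv₀ (by fun_prop) (by linarith)
      refine this.congr ?_
      filter_upwards [eventually_gt_nhds h] with u hu
      simp [hk, not_lt.mpr hu.le]
  refine ⟨cfc f b, ⟨(cfc_predicate f b : IsSelfAdjoint _), ?_⟩, ?_⟩
  · rw [← cfc_mul f f b hfc hfc]
    congr 1
    funext t
    by_cases h : t < s <;> simp [hf, h]
  · have hid : cfc (fun t : ℝ => t) b = b := cfc_id' ℝ b
    have h1 : b * b - b = cfc (fun t : ℝ => t * t - t) b := by
      rw [cfc_sub (fun t : ℝ => t * t) (fun t : ℝ => t) b (by fun_prop) (by fun_prop),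
        cfc_mul (fun t : ℝ => t) (fun t : ℝ => t) b (by fun_prop) (by fun_prop), hid]
    have h2 : b - cfc f b = (b * b - b) * cfc k b := by
      rw [h1, ← cfc_mul _ _ b (by fun_prop) hkc]
      conv_lhs => rw [← hid]
      rw [hid]
      nth_rewrite 1 [← hid]
      rw [← cfc_sub _ _ b (by fun_prop) hfc]
      congr 1
      funext t
      by_cases h : t < s
      · have : t - 1 ≠ 0 := by linarith
        simp only [hf, hk, h, if_true]
        field_simp
        ring
      · have : t ≠ 0 := by linarith
        simp only [hf, hk, h, if_false]
        field_simp
    rw [h2]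
    exact J.mul_mem_right _ _ hbJ

/-- Dual ideals of unital C*-algebras lift projections. -/
theorem dual_ideal_lifts_projections {A : Type*} [CStarAlgebra A]
    (J : TwoSidedIdeal A) (hJc : IsClosed (J : Set A)) (hJd : IsDualIdeal J)
    (a : A) (hsa : star a - a ∈ J) (hidem : a * a - a ∈ J) :
    ∃ q : A, (star q = q ∧ q * q = q) ∧ a - q ∈ J := by
  obtain ⟨T, H, i1, i2, i3, φ, hadd, hsmul, hmul, hstar, hinj, hcpt, hsurj⟩ := hJd
  have hJs : ∀ (z : ℂ) (x : A), x ∈ J → z • x ∈ J := by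
    intro z x hx
    have := J.mul_mem_left (z • 1) x hx
    simpa using this
  -- replace `a` by its real part
  set j : A := (1 / 2 : ℂ) • (star a - a) with hj
  have hjJ : j ∈ J := hJs _ _ hsa
  set b : A := a + j with hbdef
  have hb : IsSelfAdjoint b := by
    have h1 : b = (1 / 2 : ℂ) • (a + star a) := by
      rw [hbdef, hj]; module
    rw [h1, IsSelfAdjoint, star_smul, star_add, star_star, add_comm]
    simp
  have hbJ : b * b - b ∈ J := by
    have : b * b - b = (a * a - a) + (a * j + j * b - j) := by
      rw [hbdef]; noncomm_ring
    rw [this]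
    exact J.add_mem hidem (J.sub_mem (J.add_mem (J.mul_mem_left _ _ hjJ)
      (J.mul_mem_right _ _ hjJ)) hjJ)
  set h : A := b * b - b with hh
  have hstarh : star h = h := by
    rw [hh, star_sub, star_mul, hb.star_eq]
  have hφ : ∀ t, star (φ h t) = φ h t := by
    intro t
    have := hstar h hbJ
    rw [hstarh] at this
    exact (congrFun this t).symm
  obtain ⟨k1, k2⟩ := hcpt h hbJ
  have hfin := (k2 (1 / 8) (by norm_num)).biUnion
    (fun t _ => finite_spectrum_away (φ h t) (k1 t) (hφ t) (1 / 8) (by norm_num))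
  obtain ⟨c, hc, hcn⟩ := (Set.Ioo_infinite (show (-1 / 4 : ℝ) < -1 / 8 by norm_num)).exists_notMem_finite hfin
  obtain ⟨hc1, hc2⟩ := hc
  have habs : 1 / 8 < |c| := by rw [abs_of_neg (by linarith)]; linarith
  have hcspec : ∀ t, (c : ℂ) ∉ spectrum ℂ (φ h t) := by
    intro t ht
    by_cases hn : 1 / 8 ≤ ‖φ h t‖
    · exact hcn (Set.mem_biUnion (show t ∈ {t : T | 1 / 8 ≤ ‖φ h t‖} from hn) ⟨habs.le, ht⟩)
    · have h1 := spectrum.norm_le_norm_mul_of_mem ht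
      have h2 : ‖(1 : H t →L[ℂ] H t)‖ ≤ 1 := ContinuousLinearMap.norm_id_le
      have h3 : ‖(c : ℂ)‖ = |c| := by simp
      have := norm_nonneg (φ h t)
      rw [h3] at h1
      nlinarith
  have hc0 : (c : ℂ) ≠ 0 := by
    have : c ≠ 0 := by linarith
    exact_mod_cast this
  have hcA := not_mem_spectrum_of_dual J φ hadd hsmul hmul hinj hcpt hsurj h hbJ c hc0 hcspec
  -- a gap point in the spectrum of `b`
  have hpos : 0 < 1 + 4 * c := by linarith
  set r := Real.sqrt (1 + 4 * c) with hr
  have hr2 : r * r = 1 + 4 * c := Real.mul_self_sqrt hpos.le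
  have hr0 : 0 < r := Real.sqrt_pos.mpr hpos
  have hr1 : r < 1 := by nlinarith
  set s := (1 + r) / 2 with hs
  have hsc : s * s - s = c := by rw [hs]; linarith
  have hsb : s ∉ spectrum ℝ b := by
    intro hmem
    apply hcA
    have h1 : h = cfc (fun t : ℝ => t * t - t) b := by
      rw [cfc_sub (fun t : ℝ => t * t) (fun t : ℝ => t) b (by fun_prop) (by fun_prop),
        cfc_mul (fun t : ℝ => t) (fun t : ℝ => t) b (by fun_prop) (by fun_prop), cfc_id' ℝ b]
    have h2 : c ∈ spectrum ℝ h := by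
      rw [h1, cfc_map_spectrum (fun t : ℝ => t * t - t) b hb (by fun_prop)]
      exact ⟨s, hmem, hsc⟩
    exact (spectrum.algebraMap_mem_iff ℂ).mpr h2
  obtain ⟨q, hq, hqJ⟩ := lift_of_gap J b hb hbJ s (by linarith) (by linarith) hsb
  refine ⟨q, hq, ?_⟩
  have : a - q = (b - q) - j := by rw [hbdef]; abel
  rw [this]
  exact J.sub_mem hqJ hjJ
end
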